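/- (Energy concentration, Corollary 4.4.) Fix γ ∈ (0,∞) and assume W is continuous and satisfies (H1), (H2) and the normalization of the wells. Let 0 < δ < ρ and let J ⊂ ℝ be a nonempty bounded open interval. For any sequences h_n → 0⁺, ε_n → 0⁺ with h_n/ε_n → γ and any C² maps u_n : J_ρ → ℝ³ such that ∫_{J_ρ} |u_n − u₀| dx → 0, ∫_{J_ρ} |h_n⁻¹∂₃u_n − b₀| dx → 0, and lim_{n→∞} F^{h_n}_{ε_n}(u_n, J_ρ) exists in [0,∞) and equals K*_γ · ℒ¹(J), one has lim_{n→∞} F^{h_n}_{ε_n}(u_n, J_ρ ∖ J_δ) = 0. -/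

import Mathlib

open MeasureTheory Filter Topology ENNReal NNReal Set

noncomputable section

/-- Vectors in ℝ³. -/
abbrev V3 := Fin 3 → ℝ

/-- 3×3 matrices, represented as the triple of their columns. -/
abbrev M33 := Fin 3 → V3

/-- Euclidean norm on ℝ³. -/
def vnorm (v : V3) : ℝ := Real.sqrt (∑ i, (v i) ^ 2)

/-- Frobenius (Euclidean) norm on 3×3 matrices. -/
def mnorm (ξ : M33) : ℝ := Real.sqrt (∑ j, ∑ i, (ξ j i) ^ 2)

/-- dist(ξ,{A,B}). -/
def mdist (A B ξ : M33) : ℝ := min (mnorm (ξ - A)) (mnorm (ξ - B))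

/-- Spatial points of ℝ³ = ℝ × ℝ × ℝ. -/
abbrev Pt := ℝ × ℝ × ℝ

/-- Directional partial derivative of a map `u : ℝ³ → ℝ³`. -/
def pd (e : Pt) (u : Pt → V3) (x : Pt) : V3 := fderiv ℝ u x e

def e1 : Pt := (1, 0, 0)
def e2 : Pt := (0, 1, 0)
def e3 : Pt := (0, 0, 1)

/-- Rescaled gradient ∇_h u = (∂₁u, ∂₂u, h⁻¹ ∂₃u), as a 3×3 matrix of columns. -/
def gradh (h : ℝ) (u : Pt → V3) (x : Pt) : M33 :=
  ![pd e1 u x, pd e2 u x, h⁻¹ • pd e3 u x]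

/-- Squared rescaled Hessian |∇²_h u|². -/
def hessh (h : ℝ) (u : Pt → V3) (x : Pt) : ℝ :=
  (vnorm (pd e1 (pd e1 u) x)) ^ 2 + (vnorm (pd e2 (pd e2 u) x)) ^ 2
    + (h⁻¹) ^ 4 * (vnorm (pd e3 (pd e3 u) x)) ^ 2
    + 2 * (vnorm (pd e2 (pd e1 u) x)) ^ 2
    + 2 * (h⁻¹) ^ 2 * (vnorm (pd e3 (pd e1 u) x)) ^ 2
    + 2 * (h⁻¹) ^ 2 * (vnorm (pd e3 (pd e2 u) x)) ^ 2

/-- The energy F^h_ε(u, S) = ∫_S (1/ε) W(∇_h u) + ε |∇²_h u|², valued in [0,∞]. -/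
def F (W : M33 → ℝ) (h ε : ℝ) (u : Pt → V3) (S : Set Pt) : ℝ≥0∞ :=
  ∫⁻ x in S, ENNReal.ofReal (ε⁻¹ * W (gradh h u x) + ε * hessh h u x)

/-- Hypothesis (H1): W ≥ 0, {W = 0} = {A, B}, A ≠ B, and A' − B' = 2 a ⊗ ν̄ for
some a ∈ ℝ³ and a unit vector ν̄ ∈ ℝ². -/
def H1 (W : M33 → ℝ) (A B : M33) : Prop :=
  (∀ ξ, 0 ≤ W ξ) ∧ (∀ ξ, W ξ = 0 ↔ ξ = A ∨ ξ = B) ∧ A ≠ B ∧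
    ∃ (a : V3) (ν : ℝ × ℝ), ν.1 ^ 2 + ν.2 ^ 2 = 1 ∧
      A 0 - B 0 = (2 * ν.1) • a ∧ A 1 - B 1 = (2 * ν.2) • a

/-- Hypothesis (H2): p-growth from above and below. -/
def H2 (W : M33 → ℝ) (p : ℝ) : Prop :=
  ∃ C > (0 : ℝ), ∀ ξ, C⁻¹ * (mnorm ξ) ^ p - C ≤ W ξ ∧ W ξ ≤ C * (mnorm ξ) ^ p + C

/-- Hypothesis (H3): non-degeneracy near the wells. -/
def H3 (W : M33 → ℝ) (A B : M33) (p : ℝ) : Prop :=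
  ∃ ϱ > (0 : ℝ), ∃ C > (0 : ℝ), ∀ ξ, mdist A B ξ ≤ ϱ →
    C⁻¹ * (mdist A B ξ) ^ p ≤ W ξ ∧ W ξ ≤ C * (mdist A B ξ) ^ p

/-- Hypothesis (H4): W(ξ₁, 0, ξ₃) ≤ W(ξ). -/
def H4 (W : M33 → ℝ) : Prop := ∀ ξ : M33, W ![ξ 0, 0, ξ 2] ≤ W ξ

/-- Normalization of the wells: A = −B, first column of A is a, second column is 0. -/
def Wells (A B : M33) (a : V3) : Prop := A = -B ∧ A 0 = a ∧ A 1 = 0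

/-- ū₀(t) = |t| a. -/
def ub0 (a : V3) (t : ℝ) : V3 := |t| • a

/-- b̄₀(t) = A₃ for t ≥ 0, −A₃ (= B₃) for t < 0. -/
def bb0 (A3 : V3) (t : ℝ) : V3 := if 0 ≤ t then A3 else -A3

/-- u₀(x) = ū₀(x₁). -/
def u0 (a : V3) (x : Pt) : V3 := ub0 a x.1

/-- b₀(x) = b̄₀(x₁). -/
def b0 (A3 : V3) (x : Pt) : V3 := bb0 A3 x.1

/-- The interval I = (−1/2, 1/2). -/
def II : Set ℝ := Set.Ioo (-(1 / 2 : ℝ)) (1 / 2)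

/-- The unit cube Q = I × I × I. -/
def Q3 : Set Pt := II ×ˢ (II ×ˢ II)

/-- J_ρ = (ρ I) × J × I. -/
def Jrho (J : Set ℝ) (ρ : ℝ) : Set Pt := (Set.Ioo (-(ρ / 2)) (ρ / 2)) ×ˢ (J ×ˢ II)

/-- The rescaled thin domain Ω = ω × I. -/
def Om (ω : Set (ℝ × ℝ)) : Set Pt := {x | (x.1, x.2.1) ∈ ω ∧ x.2.2 ∈ II}

/-- L¹ convergence on a set U. -/
def TendsL1 (U : Set Pt) (f : ℕ → Pt → V3) (g : Pt → V3) : Prop :=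
  Tendsto (fun n => ∫⁻ x in U, ENNReal.ofReal (vnorm (f n x - g x))) atTop (nhds 0)

/-- L^q convergence on a set U. -/
def TendsLp (U : Set Pt) (q : ℝ) (f : ℕ → Pt → V3) (g : Pt → V3) : Prop :=
  Tendsto (fun n => ∫⁻ x in U, ENNReal.ofReal ((vnorm (f n x - g x)) ^ q)) atTop (nhds 0)

/-- The localized asymptotic energy 𝓔_γ(J, ρ). -/
def Egam (W : M33 → ℝ) (a A3 : V3) (γ : ℝ) (J : Set ℝ) (ρ : ℝ) : ℝ≥0∞ :=
  sInf { L : ℝ≥0∞ | ∃ (h ε : ℕ → ℝ) (u : ℕ → Pt → V3),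
    (∀ n, 0 < h n) ∧ (∀ n, 0 < ε n) ∧
    Tendsto h atTop (nhds 0) ∧ Tendsto ε atTop (nhds 0) ∧
    Tendsto (fun n => h n / ε n) atTop (nhds γ) ∧
    (∀ n, ContDiffOn ℝ 2 (u n) (Jrho J ρ)) ∧
    TendsL1 (Jrho J ρ) u (u0 a) ∧
    TendsL1 (Jrho J ρ) (fun n x => (h n)⁻¹ • pd e3 (u n) x) (b0 A3) ∧
    L = Filter.liminf (fun n => F W (h n) (ε n) (u n) (Jrho J ρ)) atTop }

/-- K*_γ = 𝓔_γ(I, 1). -/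
def Kstar (W : M33 → ℝ) (a A3 : V3) (γ : ℝ) : ℝ≥0∞ := Egam W a A3 γ II 1

/-- K*_∞ : the analogue of K*_γ for h/ε → ∞, on the unit cube Q. -/
def KstarInf (W : M33 → ℝ) (a A3 : V3) : ℝ≥0∞ :=
  sInf { L : ℝ≥0∞ | ∃ (h ε : ℕ → ℝ) (u : ℕ → Pt → V3),
    (∀ n, 0 < h n) ∧ (∀ n, 0 < ε n) ∧
    Tendsto h atTop (nhds 0) ∧ Tendsto ε atTop (nhds 0) ∧
    Tendsto (fun n => h n / ε n) atTop atTop ∧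
    (∀ n, ContDiffOn ℝ 2 (u n) Q3) ∧
    TendsL1 Q3 u (u0 a) ∧
    TendsL1 Q3 (fun n x => (h n)⁻¹ • pd e3 (u n) x) (b0 A3) ∧
    L = Filter.liminf (fun n => F W (h n) (ε n) (u n) Q3) atTop }

open Classical in
/-- The phase matrix: B on E, A off E. -/
def Mfun (A B : M33) (E : Set (ℝ × ℝ)) (x' : ℝ × ℝ) : M33 := if x' ∈ E then B else A

/-! ### Two-dimensional objects -/

abbrev Pt2 := ℝ × ℝ

/-- Directional partial derivative of a map `v : ℝ² → ℝ³`. -/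
def qd (e : Pt2) (v : Pt2 → V3) (y : Pt2) : V3 := fderiv ℝ v y e

def f1 : Pt2 := (1, 0)
def f2 : Pt2 := (0, 1)

/-- 𝒲(∇v) = W(∂₁v, 0, ∂₂v). -/
def W2 (W : M33 → ℝ) (v : Pt2 → V3) (y : Pt2) : ℝ := W ![qd f1 v y, 0, qd f2 v y]

/-- Squared 2D Hessian |∇²v|². -/
def hess2d (v : Pt2 → V3) (y : Pt2) : ℝ :=
  (vnorm (qd f1 (qd f1 v) y)) ^ 2 + 2 * (vnorm (qd f2 (qd f1 v) y)) ^ 2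
    + (vnorm (qd f2 (qd f2 v) y)) ^ 2

/-- The rectangle ℓI × γI. -/
def Rect (ℓ γ : ℝ) : Set Pt2 := Set.Ioo (-(ℓ / 2)) (ℓ / 2) ×ˢ Set.Ioo (-(γ / 2)) (γ / 2)

/-- The optimal-profile constant K_γ of the critical regime. -/
def Kgam (W : M33 → ℝ) (a A3 : V3) (γ : ℝ) : ℝ≥0∞ :=
  sInf { L : ℝ≥0∞ | ∃ ℓ > (0 : ℝ), ∃ v : Pt2 → V3,
    ContDiffOn ℝ 2 v (Rect ℓ γ) ∧
    (∃ δ > (0 : ℝ), ∀ y ∈ Rect ℓ γ, ℓ / 2 - δ < y.1 → qd f1 v y = a ∧ qd f2 v y = A3) ∧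
    (∃ δ > (0 : ℝ), ∀ y ∈ Rect ℓ γ, y.1 < -(ℓ / 2) + δ → qd f1 v y = -a ∧ qd f2 v y = -A3) ∧
    L = ENNReal.ofReal γ⁻¹ *
      ∫⁻ y in Rect ℓ γ, ENNReal.ofReal (W2 W v y + hess2d v y) }

/-- The 2D subcritical functional F⁰_ε(u, b, D). -/
def F0 (W : M33 → ℝ) (ε : ℝ) (u b : Pt2 → V3) (D : Set Pt2) : ℝ≥0∞ :=
  ∫⁻ y in D, ENNReal.ofReal (ε⁻¹ * W ![qd f1 u y, qd f2 u y, b y]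
    + ε * ((vnorm (qd f1 (qd f1 u) y)) ^ 2 + 2 * (vnorm (qd f2 (qd f1 u) y)) ^ 2
      + (vnorm (qd f2 (qd f2 u) y)) ^ 2
      + 2 * (vnorm (qd f1 b y)) ^ 2 + 2 * (vnorm (qd f2 b y)) ^ 2))

/-- K*₀: the subcritical cell constant. -/
def Kstar0 (W : M33 → ℝ) (a A3 : V3) : ℝ≥0∞ :=
  sInf { L : ℝ≥0∞ | ∃ (ε : ℕ → ℝ) (u b : ℕ → Pt2 → V3),
    (∀ n, 0 < ε n) ∧ Tendsto ε atTop (nhds 0) ∧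
    (∀ n, ContDiffOn ℝ 2 (u n) (II ×ˢ II)) ∧ (∀ n, ContDiffOn ℝ 1 (b n) (II ×ˢ II)) ∧
    Tendsto (fun n => ∫⁻ y in II ×ˢ II,
      ENNReal.ofReal (vnorm (u n y - ub0 a y.1) + vnorm (b n y - bb0 A3 y.1)))
      atTop (nhds 0) ∧
    L = Filter.liminf (fun n => F0 W (ε n) (u n) (b n) (II ×ˢ II)) atTop }

/-- K₀: the subcritical optimal-profile constant. -/
def K0 (W : M33 → ℝ) (a A3 : V3) : ℝ≥0∞ :=
  sInf { L : ℝ≥0∞ | ∃ ℓ > (0 : ℝ), ∃ φ1 φ2 : ℝ → V3,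
    ContDiffOn ℝ 1 φ1 (Set.Icc (-ℓ) ℓ) ∧ ContDiffOn ℝ 1 φ2 (Set.Icc (-ℓ) ℓ) ∧
    φ1 ℓ = a ∧ φ2 ℓ = A3 ∧ φ1 (-ℓ) = -a ∧ φ2 (-ℓ) = -A3 ∧
    L = ∫⁻ t in Set.Ioo (-ℓ) ℓ, ENNReal.ofReal (W ![φ1 t, 0, φ2 t]
      + (vnorm (derivWithin φ1 (Set.Icc (-ℓ) ℓ) t)) ^ 2
      + 2 * (vnorm (derivWithin φ2 (Set.Icc (-ℓ) ℓ) t)) ^ 2) }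

/-- K_∞ in the case λ = 0. -/
def KinfZero (W : M33 → ℝ) (a : V3) : ℝ≥0∞ :=
  sInf { L : ℝ≥0∞ | ∃ ℓ > (0 : ℝ), ∃ v : Pt2 → V3,
    ContDiff ℝ 2 v ∧ (∀ y : Pt2, v (y.1, y.2 + 1) = v y) ∧
    (∃ δ > (0 : ℝ), ∀ y : Pt2, |y.1 - 1 / 2| < δ → qd f1 v y = a ∧ qd f2 v y = 0) ∧
    (∃ δ > (0 : ℝ), ∀ y : Pt2, |y.1 + 1 / 2| < δ → qd f1 v y = -a ∧ qd f2 v y = 0) ∧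
    L = ∫⁻ y in II ×ˢ II, ENNReal.ofReal (ℓ * W2 W v y + ℓ⁻¹ * hess2d v y) }

/-- The unit normal ν_λ = (1+λ²)^{-1/2} (1, λ). -/
def nuv (lam : ℝ) : Pt2 := (1 / Real.sqrt (1 + lam ^ 2), lam / Real.sqrt (1 + lam ^ 2))

/-- The orthogonal direction ν_λ^⊥ = (1+λ²)^{-1/2} (−λ, 1). -/
def nupv (lam : ℝ) : Pt2 := (-lam / Real.sqrt (1 + lam ^ 2), 1 / Real.sqrt (1 + lam ^ 2))

/-- Dot product on ℝ². -/
def dotp (w y : Pt2) : ℝ := w.1 * y.1 + w.2 * y.2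

/-- The unit square Q'_λ centered at 0 with two sides orthogonal to ν_λ. -/
def Qlam (lam : ℝ) : Set Pt2 := {y | |dotp (nuv lam) y| < 1 / 2 ∧ |dotp (nupv lam) y| < 1 / 2}

/-- K_∞ for general λ. -/
def KinfL (W : M33 → ℝ) (a : V3) (lam : ℝ) : ℝ≥0∞ :=
  ENNReal.ofReal (Real.sqrt (1 + lam ^ 2)) *
    sInf { L : ℝ≥0∞ | ∃ ℓ > (0 : ℝ), ∃ v : Pt2 → V3,
      ContDiff ℝ 2 v ∧ (∀ y : Pt2, v (y + nupv lam) = v y) ∧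
      (∃ δ > (0 : ℝ), ∀ y : Pt2, |dotp (nuv lam) y - 1 / 2| < δ →
        qd f1 v y = a ∧ qd f2 v y = lam • a) ∧
      (∃ δ > (0 : ℝ), ∀ y : Pt2, |dotp (nuv lam) y + 1 / 2| < δ →
        qd f1 v y = -a ∧ qd f2 v y = -(lam • a)) ∧
      L = ∫⁻ y in Qlam lam, ENNReal.ofReal (ℓ * W2 W v y + ℓ⁻¹ * hess2d v y) }

/-- Number of interfaces strictly below t. -/
def cnt (m : ℕ) (α : Fin m → ℝ) (t : ℝ) : ℕ := (Finset.univ.filter (fun i => α i < t)).card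

end
/-- The affine change of variables `x ↦ (α x₁, t + α x₂, x₃)`. -/
def dilate (α t : ℝ) (x : Pt) : Pt := (α * x.1, t + α * x.2.1, x.2.2)

/-- The linear part of `dilate α t`. -/
def dilateLin (α : ℝ) : Pt →L[ℝ] Pt :=
  (α • ContinuousLinearMap.id ℝ ℝ).prodMap
    ((α • ContinuousLinearMap.id ℝ ℝ).prodMap (ContinuousLinearMap.id ℝ ℝ))

theorem dilateLin_apply (α : ℝ) (x : Pt) :
    dilateLin α x = (α * x.1, α * x.2.1, x.2.2) := by
  rfl

theorem dilate_eq (α t : ℝ) (x : Pt) : dilate α t x = ((0, t, 0) : Pt) + dilateLin α x := by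
  simp [dilate, dilateLin_apply]

theorem det_dilateLin (α : ℝ) : (dilateLin α).det = α ^ 2 := by
  have h : ((dilateLin α : Pt →L[ℝ] Pt) : Pt →ₗ[ℝ] Pt) =
      (α • (LinearMap.id : ℝ →ₗ[ℝ] ℝ)).prodMap
        ((α • (LinearMap.id : ℝ →ₗ[ℝ] ℝ)).prodMap LinearMap.id) := rfl
  rw [ContinuousLinearMap.det, h, LinearMap.det_prodMap, LinearMap.det_prodMap]
  simp [sq]

/-- `dilateLin α` as an equivalence for `α ≠ 0`. -/
noncomputable def dilateEquiv (α : ℝ) (hα : α ≠ 0) : Pt ≃L[ℝ] Pt :=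
  ContinuousLinearEquiv.equivOfInverse (dilateLin α) (dilateLin α⁻¹)
    (fun x => by simp [dilateLin_apply, hα]) (fun x => by simp [dilateLin_apply, hα])

theorem hasFDerivAt_dilate (α t : ℝ) (x : Pt) : HasFDerivAt (dilate α t) (dilateLin α) x := by
  rw [show dilate α t = fun x => ((0, t, 0) : Pt) + dilateLin α x from funext (dilate_eq α t)]
  exact (dilateLin α).hasFDerivAt.const_add _

theorem injective_dilate {α : ℝ} (hα : α ≠ 0) (t : ℝ) : Function.Injective (dilate α t) := by
  rintro ⟨x, y, z⟩ ⟨x', y', z'⟩ h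
  simpa [dilate, hα] using h

theorem setLIntegral_image_dilate {α : ℝ} (hα : 0 < α) (t : ℝ) {S : Set Pt} (hS : MeasurableSet S)
    (g : Pt → ℝ≥0∞) :
    ∫⁻ x in dilate α t '' S, g x = ENNReal.ofReal (α ^ 2) * ∫⁻ x in S, g (dilate α t x) := by
  have : (volume : Measure Pt).IsAddHaarMeasure := by
    have : (volume : Measure (ℝ × ℝ)).IsAddHaarMeasure :=
      Measure.prod.instIsAddHaarMeasure volume volume
    exact Measure.prod.instIsAddHaarMeasure volume volume
  rw [lintegral_image_eq_lintegral_abs_det_fderiv_mul volume hS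
    (fun x _ => (hasFDerivAt_dilate α t x).hasFDerivWithinAt) (injective_dilate hα.ne' t).injOn]
  simp only [det_dilateLin, abs_of_pos (pow_pos hα 2)]
  exact lintegral_const_mul' _ _ ENNReal.ofReal_ne_top

theorem pd_smul_comp_dilate {α : ℝ} (hα : 0 < α) (t β : ℝ) (hβ : β ≠ 0) (u : Pt → V3) (e x : Pt) :
    pd e (fun y => β • u (dilate α t y)) x = β • pd (dilateLin α e) u (dilate α t x) := by
  have hc : fderiv ℝ (fun y => u (dilate α t y)) x
      = (fderiv ℝ u (dilate α t x)).comp (dilateLin α) := by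
    have hfun : (fun y => u (dilate α t y))
        = (fun z => u (((0, t, 0) : Pt) + z)) ∘ dilateEquiv α hα.ne' := by
      funext y; rw [dilate_eq]; rfl
    rw [hfun, ContinuousLinearEquiv.comp_right_fderiv, fderiv_comp_add_left, dilate_eq]
    rfl
  have hs : fderiv ℝ (fun y => β • u (dilate α t y)) x
      = β • fderiv ℝ (fun y => u (dilate α t y)) x := by
    let := invertibleOfNonzero hβ
    exact fderiv_const_smul_of_invertible (f := fun y => u (dilate α t y)) β
  simp only [pd, hs, hc]
  rfl

/-- The rescaling `x ↦ α⁻¹ u(α x₁, t + α x₂, x₃)`, which preserves the rescaled gradient when the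
thickness is divided by `α`. -/
noncomputable def rescale (α t : ℝ) (u : Pt → V3) (x : Pt) : V3 := α⁻¹ • u (dilate α t x)

theorem dilateLin_e1 (α : ℝ) : dilateLin α e1 = α • e1 := by simp [dilateLin_apply, e1]

theorem dilateLin_e2 (α : ℝ) : dilateLin α e2 = α • e2 := by simp [dilateLin_apply, e2]

theorem dilateLin_e3 (α : ℝ) : dilateLin α e3 = e3 := by simp [dilateLin_apply, e3]

theorem pd_smul_direction (k : ℝ) (e : Pt) (u : Pt → V3) (x : Pt) :
    pd (k • e) u x = k • pd e u x := by
  simp [pd]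

theorem pd_rescale_of_smul {α : ℝ} (hα : 0 < α) (t : ℝ) (u : Pt → V3) {e : Pt}
    (he : dilateLin α e = α • e) :
    pd e (rescale α t u) = fun x => pd e u (dilate α t x) := by
  funext x
  unfold rescale
  rw [pd_smul_comp_dilate hα t _ (inv_ne_zero hα.ne'), he, pd_smul_direction, smul_smul,
    inv_mul_cancel₀ hα.ne', one_smul]

theorem pd_e3_rescale {α : ℝ} (hα : 0 < α) (t : ℝ) (u : Pt → V3) :
    pd e3 (rescale α t u) = fun x => α⁻¹ • pd e3 u (dilate α t x) := by
  funext x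
  unfold rescale
  rw [pd_smul_comp_dilate hα t _ (inv_ne_zero hα.ne'), dilateLin_e3]

theorem pd_comp_dilate {α : ℝ} (hα : 0 < α) (t : ℝ) (u : Pt → V3) (e x : Pt) :
    pd e (fun y => u (dilate α t y)) x = pd (dilateLin α e) u (dilate α t x) := by
  simpa using pd_smul_comp_dilate hα t 1 one_ne_zero u e x

theorem vnorm_smul {k : ℝ} (hk : 0 ≤ k) (v : V3) : vnorm (k • v) = k * vnorm v := by
  unfold vnorm
  simp only [Pi.smul_apply, smul_eq_mul, mul_pow, ← Finset.mul_sum]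
  rw [Real.sqrt_mul (sq_nonneg k), Real.sqrt_sq hk]

theorem inv_div_smul_pd_e3_rescale {α : ℝ} (hα : 0 < α) (t h : ℝ) (u : Pt → V3) (x : Pt) :
    (h / α)⁻¹ • pd e3 (rescale α t u) x = h⁻¹ • pd e3 u (dilate α t x) := by
  rw [pd_e3_rescale hα, smul_smul]
  congr 1
  rw [inv_div, div_eq_mul_inv, mul_assoc, mul_comm h⁻¹, ← mul_assoc, mul_inv_cancel₀ hα.ne',
    one_mul]

theorem gradh_rescale {α : ℝ} (hα : 0 < α) (t h : ℝ) (u : Pt → V3) (x : Pt) :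
    gradh (h / α) (rescale α t u) x = gradh h u (dilate α t x) := by
  unfold gradh
  rw [inv_div_smul_pd_e3_rescale hα, pd_rescale_of_smul hα t u (dilateLin_e1 α),
    pd_rescale_of_smul hα t u (dilateLin_e2 α)]

theorem hessh_rescale {α : ℝ} (hα : 0 < α) (t h : ℝ) (u : Pt → V3) (x : Pt) :
    hessh (h / α) (rescale α t u) x = α ^ 2 * hessh h u (dilate α t x) := by
  unfold hessh
  rw [pd_e3_rescale hα, pd_rescale_of_smul hα t u (dilateLin_e1 α),
    pd_rescale_of_smul hα t u (dilateLin_e2 α)]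
  simp only [pd_comp_dilate hα, pd_smul_comp_dilate hα t _ (inv_ne_zero hα.ne'), dilateLin_e1,
    dilateLin_e2, dilateLin_e3, pd_smul_direction, vnorm_smul hα.le,
    vnorm_smul (inv_nonneg.2 hα.le), div_eq_mul_inv]
  field_simp

theorem measurableSet_II : MeasurableSet II := measurableSet_Ioo

theorem measurableSet_Jrho {J : Set ℝ} (hJ : MeasurableSet J) (ρ : ℝ) :
    MeasurableSet (Jrho J ρ) :=
  measurableSet_Ioo.prod (hJ.prod measurableSet_II)

theorem F_image_dilate (W : M33 → ℝ) {α : ℝ} (hα : 0 < α) (t h ε : ℝ) (u : Pt → V3) {S : Set Pt}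
    (hS : MeasurableSet S) :
    F W h ε u (dilate α t '' S)
      = ENNReal.ofReal α * F W (h / α) (ε / α) (rescale α t u) S := by
  unfold F
  rw [setLIntegral_image_dilate hα t hS, sq, ENNReal.ofReal_mul hα.le, mul_assoc,
    ← lintegral_const_mul' _ _ ENNReal.ofReal_ne_top]
  congr 2
  funext x
  rw [gradh_rescale hα, hessh_rescale hα, ← ENNReal.ofReal_mul hα.le]
  congr 1
  field_simp

theorem dilate_image_subset {α δ : ℝ} (hα : 0 < α) (hαδ : α ≤ δ) (t : ℝ) :
    dilate α t '' Jrho II 1 ⊆ Jrho (Ioo (t - α / 2) (t + α / 2)) δ := by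
  rintro _ ⟨⟨x, y, z⟩, ⟨⟨hx, hx'⟩, ⟨hy, hy'⟩, hz⟩, rfl⟩
  refine ⟨⟨?_, ?_⟩, ⟨?_, ?_⟩, hz⟩ <;> simp only [dilate] at * <;> nlinarith

theorem Jrho_mono {J J' : Set ℝ} (hJ : J ⊆ J') {ρ ρ' : ℝ} (hρ : ρ ≤ ρ') :
    Jrho J ρ ⊆ Jrho J' ρ' :=
  Set.prod_mono (Ioo_subset_Ioo (by linarith) (by linarith)) (Set.prod_mono hJ subset_rfl)

theorem u0_dilate {α : ℝ} (hα : 0 < α) (t : ℝ) (a : V3) (x : Pt) :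
    u0 a (dilate α t x) = α • u0 a x := by
  simp [u0, ub0, dilate, abs_mul, abs_of_pos hα, smul_smul]

theorem b0_dilate {α : ℝ} (hα : 0 < α) (t : ℝ) (b : V3) (x : Pt) :
    b0 b (dilate α t x) = b0 b x := by
  simp [b0, bb0, dilate, hα]

theorem setLIntegral_comp_dilate {α : ℝ} (hα : 0 < α) (t : ℝ) {S : Set Pt} (hS : MeasurableSet S)
    (g : Pt → ℝ≥0∞) :
    ∫⁻ x in S, g (dilate α t x)
      = (ENNReal.ofReal (α ^ 2))⁻¹ * ∫⁻ x in dilate α t '' S, g x := by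
  rw [setLIntegral_image_dilate hα t hS, ← mul_assoc, ENNReal.inv_mul_cancel _
    ENNReal.ofReal_ne_top, one_mul]
  exact (ENNReal.ofReal_pos.2 (pow_pos hα 2)).ne'

theorem TendsL1.mono {U V : Set Pt} (hUV : U ⊆ V) {f : ℕ → Pt → V3} {g : Pt → V3}
    (hf : TendsL1 V f g) : TendsL1 U f g :=
  tendsto_of_tendsto_of_tendsto_of_le_of_le tendsto_const_nhds hf (fun _ => zero_le)
    (fun _ => lintegral_mono_set hUV)

theorem TendsL1.comp_dilate {α : ℝ} (hα : 0 < α) (t : ℝ) {S : Set Pt} (hS : MeasurableSet S)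
    {f : ℕ → Pt → V3} {g : Pt → V3} (hf : TendsL1 (dilate α t '' S) f g) :
    TendsL1 S (fun n x => f n (dilate α t x)) (fun x => g (dilate α t x)) := by
  unfold TendsL1 at *
  have hc : (ENNReal.ofReal (α ^ 2))⁻¹ ≠ ⊤ :=
    ENNReal.inv_ne_top.2 (ENNReal.ofReal_pos.2 (pow_pos hα 2)).ne'
  have hlim := ENNReal.Tendsto.const_mul hf (Or.inr hc)
  rw [mul_zero] at hlim
  exact hlim.congr fun n => (setLIntegral_comp_dilate hα t hS
    (fun x => ENNReal.ofReal (vnorm (f n x - g x)))).symm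

theorem TendsL1.const_smul {U : Set Pt} {k : ℝ} (hk : 0 ≤ k) {f : ℕ → Pt → V3} {g : Pt → V3}
    (hf : TendsL1 U f g) : TendsL1 U (fun n x => k • f n x) (fun x => k • g x) := by
  unfold TendsL1 at *
  simp only [← smul_sub, vnorm_smul hk, ENNReal.ofReal_mul hk,
    lintegral_const_mul' _ _ (ENNReal.ofReal_ne_top (r := k))]
  simpa using ENNReal.Tendsto.const_mul hf (Or.inr (ENNReal.ofReal_ne_top (r := k)))

theorem contDiffOn_rescale {α : ℝ} (t : ℝ) {u : Pt → V3} {S : Set Pt}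
    (hu : ContDiffOn ℝ 2 u (dilate α t '' S)) : ContDiffOn ℝ 2 (rescale α t u) S := by
  have hd : ContDiff ℝ 2 (dilate α t) := by unfold dilate; fun_prop
  exact (hu.comp hd.contDiffOn (mapsTo_image _ _)).const_smul α⁻¹

/-- Blow-up: on a cell of side `α` the asymptotic energy is at least `α` times the one of the
unit cell. -/
theorem Kstar_le_liminf_rescale (W : M33 → ℝ) (a b : V3) (γ : ℝ) {α : ℝ} (hα : 0 < α) (t : ℝ)
    {h ε : ℕ → ℝ} (hh : ∀ n, 0 < h n) (hε : ∀ n, 0 < ε n)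
    (hh0 : Tendsto h atTop (nhds 0)) (hε0 : Tendsto ε atTop (nhds 0))
    (hratio : Tendsto (fun n => h n / ε n) atTop (nhds γ)) {u : ℕ → Pt → V3}
    (hu : ∀ n, ContDiffOn ℝ 2 (u n) (dilate α t '' Jrho II 1))
    (hL1u : TendsL1 (dilate α t '' Jrho II 1) u (u0 a))
    (hL1b : TendsL1 (dilate α t '' Jrho II 1) (fun n x => (h n)⁻¹ • pd e3 (u n) x) (b0 b)) :
    Kstar W a b γ ≤ liminf
      (fun n => F W (h n / α) (ε n / α) (rescale α t (u n)) (Jrho II 1)) atTop := by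
  have hS : MeasurableSet (Jrho II 1) := measurableSet_Jrho measurableSet_II 1
  refine sInf_le ⟨fun n => h n / α, fun n => ε n / α, fun n => rescale α t (u n),
    fun n => div_pos (hh n) hα, fun n => div_pos (hε n) hα, by simpa using hh0.div_const α,
    by simpa using hε0.div_const α, ?_, fun n => contDiffOn_rescale t (hu n), ?_, ?_, rfl⟩
  · simpa only [div_div_div_cancel_right₀ hα.ne'] using hratio
  · have := (hL1u.comp_dilate hα t hS).const_smul (inv_nonneg.2 hα.le)
    simp only [u0_dilate hα, smul_smul, inv_mul_cancel₀ hα.ne', one_smul] at this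
    exact this
  · have := hL1b.comp_dilate hα t hS
    simpa only [b0_dilate hα, inv_div_smul_pd_e3_rescale hα] using this

/-- The lower bound `Kstar * |J| ≤ liminf F(J_δ)`, for every width `δ`, in eventual form. -/
theorem eventually_mul_volume_le_F (W : M33 → ℝ) (a b : V3) (γ : ℝ) {δ c d : ℝ} (hδ : 0 < δ)
    (hcd : c < d) {h ε : ℕ → ℝ} (hh : ∀ n, 0 < h n) (hε : ∀ n, 0 < ε n)
    (hh0 : Tendsto h atTop (nhds 0)) (hε0 : Tendsto ε atTop (nhds 0))
    (hratio : Tendsto (fun n => h n / ε n) atTop (nhds γ)) {u : ℕ → Pt → V3}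
    (hu : ∀ n, ContDiffOn ℝ 2 (u n) (Jrho (Ioo c d) δ))
    (hL1u : TendsL1 (Jrho (Ioo c d) δ) u (u0 a))
    (hL1b : TendsL1 (Jrho (Ioo c d) δ) (fun n x => (h n)⁻¹ • pd e3 (u n) x) (b0 b))
    {k : ℝ≥0∞} (hk : k < Kstar W a b γ) :
    ∀ᶠ n in atTop, k * volume (Ioo c d) ≤ F W (h n) (ε n) (u n) (Jrho (Ioo c d) δ) := by
  have hS : MeasurableSet (Jrho II 1) := measurableSet_Jrho measurableSet_II 1
  obtain ⟨m, hm⟩ := exists_nat_gt ((d - c) / δ)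
  have hm0 : (0 : ℝ) < m := lt_trans (div_pos (sub_pos.2 hcd) hδ) hm
  set α : ℝ := (d - c) / m with hαdef
  have hα : 0 < α := div_pos (sub_pos.2 hcd) hm0
  have hmα : m * α = d - c := by rw [hαdef]; field_simp
  have hαδ : α ≤ δ := by
    rw [hαdef, div_le_iff₀ hm0]
    rw [div_lt_iff₀ hδ] at hm
    linarith
  let t : ℕ → ℝ := fun i => c + (i + 1 / 2) * α
  have hsub : ∀ i ∈ Finset.range m, dilate α (t i) '' Jrho II 1 ⊆ Jrho (Ioo c d) δ := by
    intro i hi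
    have him : (i : ℝ) + 1 ≤ m := by exact_mod_cast Finset.mem_range.1 hi
    have hi0 : (0 : ℝ) ≤ i := Nat.cast_nonneg i
    refine (dilate_image_subset hα hαδ (t i)).trans
      (Jrho_mono (Ioo_subset_Ioo ?_ ?_) le_rfl) <;> simp only [t] <;> nlinarith
  have hdisj : Set.PairwiseDisjoint (↑(Finset.range m))
      (fun i => dilate α (t i) '' Jrho II 1) := by
    have key : ∀ i j : ℕ, i < j → Disjoint (dilate α (t i) '' Jrho II 1)
        (dilate α (t j) '' Jrho II 1) := by
      intro i j hij
      rw [Set.disjoint_left]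
      intro x hx hx'
      have h1 := (dilate_image_subset hα le_rfl (t i) hx).2.1.2
      have h2 := (dilate_image_subset hα le_rfl (t j) hx').2.1.1
      have hij' : (i : ℝ) + 1 ≤ j := by exact_mod_cast hij
      simp only [t] at h1 h2
      nlinarith
    intro i _ j _ hij
    rcases lt_or_gt_of_ne hij with h' | h'
    · exact key i j h'
    · exact (key j i h').symm
  have hmeas : ∀ i ∈ Finset.range m, MeasurableSet (dilate α (t i) '' Jrho II 1) := fun i _ =>
    measurable_image_of_fderivWithin hS
      (fun x _ => (hasFDerivAt_dilate α (t i) x).hasFDerivWithinAt)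
      (injective_dilate hα.ne' (t i)).injOn
  have hev : ∀ᶠ n in atTop, ∀ i ∈ Finset.range m,
      k < F W (h n / α) (ε n / α) (rescale α (t i) (u n)) (Jrho II 1) := by
    rw [Filter.eventually_all_finset]
    intro i hi
    exact eventually_lt_of_lt_liminf (hk.trans_le (Kstar_le_liminf_rescale W a b γ hα (t i) hh hε
      hh0 hε0 hratio (fun n => (hu n).mono (hsub i hi)) (hL1u.mono (hsub i hi))
      (hL1b.mono (hsub i hi))))
  filter_upwards [hev] with n hn
  calc k * volume (Ioo c d) = ∑ _i ∈ Finset.range m, ENNReal.ofReal α * k := by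
        rw [Real.volume_Ioo, ← hmα, ENNReal.ofReal_mul hm0.le, ENNReal.ofReal_natCast,
          Finset.sum_const, Finset.card_range, nsmul_eq_mul]
        ring
    _ ≤ ∑ i ∈ Finset.range m, F W (h n) (ε n) (u n) (dilate α (t i) '' Jrho II 1) := by
        refine Finset.sum_le_sum fun i hi => ?_
        rw [F_image_dilate W hα (t i) _ _ _ hS]
        gcongr
        exact (hn i hi).le
    _ = F W (h n) (ε n) (u n) (⋃ i ∈ Finset.range m, dilate α (t i) '' Jrho II 1) :=
        (lintegral_biUnion_finset hdisj hmeas _).symm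
    _ ≤ F W (h n) (ε n) (u n) (Jrho (Ioo c d) δ) :=
        lintegral_mono_set (Set.iUnion₂_subset hsub)

/-- If `y + z = x → M < ∞` and `M ≤ liminf y`, then `z → 0`. -/
theorem tendsto_zero_of_add_eq {x y z : ℕ → ℝ≥0∞} {M : ℝ≥0∞} (hM : M ≠ ⊤)
    (hxyz : ∀ n, y n + z n = x n) (hx : Tendsto x atTop (nhds M))
    (hy : ∀ c < M, ∀ᶠ n in atTop, c ≤ y n) : Tendsto z atTop (nhds 0) := by
  have hmin : Tendsto (fun n => min (y n) M) atTop (nhds M) := by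
    refine tendsto_order.2 ⟨fun c hc => ?_, fun c hc => Eventually.of_forall fun n =>
      (min_le_right _ _).trans_lt hc⟩
    obtain ⟨c', hc', hc'M⟩ := exists_between hc
    filter_upwards [hy c' hc'M] with n hn
    exact lt_min (hc'.trans_le hn) hc
  have hsub := ENNReal.Tendsto.sub hx hmin (Or.inl hM)
  rw [tsub_self] at hsub
  refine tendsto_of_tendsto_of_tendsto_of_le_of_le tendsto_const_nhds hsub (fun _ => zero_le)
    fun n => ?_
  refine ENNReal.le_sub_of_add_le_left ((min_le_right _ _).trans_lt hM.lt_top).ne ?_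
  rw [← hxyz n]
  gcongr
  exact min_le_left _ _

/-- Corollary 4.4, energy concentration. -/
theorem statement6 (p : ℝ) (hp : 2 ≤ p) (A B : M33) (W : M33 → ℝ) (a : V3)
    (hWc : Continuous W) (h1 : H1 W A B) (h2 : H2 W p)
    (hwells : Wells A B a) (γ : ℝ) (hγ : 0 < γ)
    (δ ρ : ℝ) (hδ : 0 < δ) (hδρ : δ < ρ) (c d : ℝ) (hcd : c < d)
    (h ε : ℕ → ℝ) (hh : ∀ n, 0 < h n) (hε : ∀ n, 0 < ε n)
    (hh0 : Tendsto h atTop (nhds 0)) (hε0 : Tendsto ε atTop (nhds 0))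
    (hratio : Tendsto (fun n => h n / ε n) atTop (nhds γ))
    (u : ℕ → Pt → V3) (hu : ∀ n, ContDiffOn ℝ 2 (u n) (Jrho (Set.Ioo c d) ρ))
    (hL1u : TendsL1 (Jrho (Set.Ioo c d) ρ) u (u0 a))
    (hL1b : TendsL1 (Jrho (Set.Ioo c d) ρ)
      (fun n x => (h n)⁻¹ • pd e3 (u n) x) (b0 (A 2)))
    (hfin : Kstar W a (A 2) γ * volume (Set.Ioo c d) ≠ ⊤)
    (hlim : Tendsto (fun n => F W (h n) (ε n) (u n) (Jrho (Set.Ioo c d) ρ)) atTop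
      (nhds (Kstar W a (A 2) γ * volume (Set.Ioo c d)))) :
    Tendsto (fun n => F W (h n) (ε n) (u n)
      (Jrho (Set.Ioo c d) ρ \ Jrho (Set.Ioo c d) δ)) atTop (nhds 0) := by
  have hsub : Jrho (Ioo c d) δ ⊆ Jrho (Ioo c d) ρ := Jrho_mono subset_rfl hδρ.le
  have hvol : volume (Ioo c d) ≠ 0 := by simp [Real.volume_Ioo, hcd]
  have hvol' : volume (Ioo c d) ≠ ⊤ := by simp [Real.volume_Ioo]
  refine tendsto_zero_of_add_eq (y := fun n => F W (h n) (ε n) (u n) (Jrho (Ioo c d) δ)) hfin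
    (fun n => ?_) hlim fun k hk => ?_
  · have := lintegral_inter_add_sdiff (μ := volume)
      (fun x => ENNReal.ofReal ((ε n)⁻¹ * W (gradh (h n) (u n) x) + ε n * hessh (h n) (u n) x))
      (Jrho (Ioo c d) ρ) (measurableSet_Jrho (measurableSet_Ioo (a := c) (b := d)) δ)
    rwa [inter_eq_self_of_subset_right hsub] at this
  · have hk' : k / volume (Ioo c d) < Kstar W a (A 2) γ :=
      (ENNReal.div_lt_iff (Or.inl hvol) (Or.inl hvol')).2 hk
    simpa only [ENNReal.div_mul_cancel hvol hvol'] using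
      eventually_mul_volume_le_F W a (A 2) γ hδ hcd hh hε hh0 hε0 hratio
        (fun n => (hu n).mono hsub) (hL1u.mono hsub) (hL1b.mono hsub) hk'
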